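/- arXiv:1705.07583 — 6 statements merged into one kernel-verified Lean document; each statement's English description precedes it below -/
import Mathlib

section
/- Let G = (V,E,ω) be a finite, connected, undirected simple weighted graph and ρ ∈ P_o(G). For any skew-symmetric vector field v = (v_{jl})_{(j,l)∈E} (i.e. v_{lj} = −v_{jl}), there exist a function S ∈ ℝⁿ on the nodes and a skew-symmetric field u = (u_{jl})_{(j,l)∈E} with div_G(ρu) = 0 such that v_{jl} = √(ω_{jl})·(S_j − S_l) + u_{jl} for all (j,l) ∈ E. Moreover the potential part is unique: S is unique up to an additive constant, hence the gradient field (√(ω_{jl})(S_j − S_l))_{(j,l)∈E} is unique. -/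
open Finset

section WeightedLaplacian

variable {V : Type*} [Fintype V]

/-- The Laplacian `S ↦ (∑ l, c j l * (S j - S l))_j` with conductances `c`. -/
def weightedLaplacian (c : V → V → ℝ) : (V → ℝ) →ₗ[ℝ] (V → ℝ) where
  toFun S j := ∑ l, c j l * (S j - S l)
  map_add' S T := by
    ext j
    simp only [Pi.add_apply, ← sum_add_distrib]
    exact sum_congr rfl fun l _ => by ring
  map_smul' a S := by
    ext j
    simp only [Pi.smul_apply, smul_eq_mul, RingHom.id_apply, mul_sum]
    exact sum_congr rfl fun l _ => by ring

theorem weightedLaplacian_apply (c : V → V → ℝ) (S : V → ℝ) (j : V) :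
    weightedLaplacian c S j = ∑ l, c j l * (S j - S l) := rfl

theorem sum_sum_eq_zero_of_skew {f : V → V → ℝ} (hf : ∀ j l, f l j = -f j l) :
    ∑ j, ∑ l, f j l = 0 := by
  have h : ∑ j, ∑ l, f j l = -∑ j, ∑ l, f j l := by
    conv_lhs => rw [sum_comm]
    simp only [← sum_neg_distrib]
    exact sum_congr rfl fun j _ => sum_congr rfl fun l _ => hf j l
  linarith

theorem sum_weightedLaplacian {c : V → V → ℝ} (hc : ∀ j l, c j l = c l j) (S : V → ℝ) :
    ∑ j, weightedLaplacian c S j = 0 :=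
  sum_sum_eq_zero_of_skew fun j l => by rw [hc l j]; ring

theorem two_mul_sum_mul_weightedLaplacian {c : V → V → ℝ} (hc : ∀ j l, c j l = c l j)
    (S : V → ℝ) :
    2 * ∑ j, S j * weightedLaplacian c S j = ∑ j, ∑ l, c j l * (S j - S l) ^ 2 := by
  have h : ∑ j, ∑ l, c j l * (S j ^ 2 - S l ^ 2) = 0 :=
    sum_sum_eq_zero_of_skew fun j l => by rw [hc l j]; ring
  rw [← add_zero (∑ j, ∑ l, c j l * (S j - S l) ^ 2), ← h]
  simp only [weightedLaplacian_apply, mul_sum, ← sum_add_distrib]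
  exact sum_congr rfl fun j _ => sum_congr rfl fun l _ => by ring

variable {G : SimpleGraph V} {c : V → V → ℝ}

theorem eq_of_weightedLaplacian_eq_zero (hG : G.Connected) (hc : ∀ j l, c j l = c l j)
    (hnonneg : ∀ j l, 0 ≤ c j l) (hpos : ∀ j l, G.Adj j l → 0 < c j l)
    {S : V → ℝ} (hS : weightedLaplacian c S = 0) (i j : V) : S i = S j := by
  have henergy := two_mul_sum_mul_weightedLaplacian hc S
  simp only [hS, Pi.zero_apply, mul_zero, sum_const_zero] at henergy
  have hterm (j l : V) : 0 ≤ c j l * (S j - S l) ^ 2 :=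
    mul_nonneg (hnonneg j l) (sq_nonneg _)
  have hadj (j l : V) (h : G.Adj j l) : S j = S l := by
    have h₁ := (sum_eq_zero_iff_of_nonneg fun j _ => sum_nonneg fun l _ => hterm j l).1
      henergy.symm j (mem_univ j)
    have h₂ := (sum_eq_zero_iff_of_nonneg fun l _ => hterm j l).1 h₁ l (mem_univ l)
    exact sub_eq_zero.1 (pow_eq_zero_iff two_ne_zero |>.1
      ((mul_eq_zero.1 h₂).resolve_left (hpos j l h).ne'))
  obtain ⟨p⟩ := hG.preconnected i j
  induction p with
  | nil => rfl
  | cons h _ ih => exact (hadj _ _ h).trans ih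

theorem exists_weightedLaplacian_eq (hG : G.Connected) (hc : ∀ j l, c j l = c l j)
    (hnonneg : ∀ j l, 0 ≤ c j l) (hpos : ∀ j l, G.Adj j l → 0 < c j l)
    {b : V → ℝ} (hb : ∑ j, b j = 0) : ∃ S, weightedLaplacian c S = b := by
  have : Nonempty V := hG.nonempty
  have hcard : (Fintype.card V : ℝ) ≠ 0 := Nat.cast_ne_zero.2 Fintype.card_ne_zero
  let T : (V → ℝ) →ₗ[ℝ] (V → ℝ) :=
    weightedLaplacian c + LinearMap.pi fun _ => ∑ i, LinearMap.proj i
  have hT (S : V → ℝ) (j : V) : T S j = weightedLaplacian c S j + ∑ i, S i := by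
    simp [T, LinearMap.sum_apply]
  have key (S : V → ℝ) (hS : ∑ j, T S j = 0) : ∑ i, S i = 0 := by
    simpa [hT, sum_add_distrib, sum_weightedLaplacian hc, hcard] using hS
  have hlap (S : V → ℝ) (hS : ∑ j, T S j = 0) : weightedLaplacian c S = T S := by
    ext j
    rw [hT, key S hS, add_zero]
  have hinj : Function.Injective T := by
    refine (injective_iff_map_eq_zero T).2 fun S hS => ?_
    have hsum : ∑ j, T S j = 0 := by simp [hS]
    have hconst := eq_of_weightedLaplacian_eq_zero hG hc hnonneg hpos ((hlap S hsum).trans hS)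
    ext j
    have h := key S hsum
    rw [sum_congr rfl fun i _ => hconst i j] at h
    simpa [hcard] using h
  obtain ⟨S, rfl⟩ := LinearMap.injective_iff_surjective.1 hinj b
  exact ⟨S, hlap S hb⟩

end WeightedLaplacian

/-- Hodge decomposition on a graph: on a finite connected weighted graph,
given `ρ` in the interior of the probability simplex, any skew-symmetric vector field `v`
on the edges decomposes as `v = ∇_G S + u` with `div_G(ρ u) = 0`, and the potential `S`
is unique up to an additive constant (hence the gradient part is unique). -/
theorem graph_hodge_decomposition {n : ℕ}
    (G : SimpleGraph (Fin n)) [DecidableRel G.Adj] (hconn : G.Connected)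
    (ω : Fin n → Fin n → ℝ) (hω : ∀ j l, ω j l = ω l j)
    (hωpos : ∀ j l, G.Adj j l → 0 < ω j l)
    (ρ : Fin n → ℝ) (hρpos : ∀ j, 0 < ρ j) (hρsum : ∑ j, ρ j = 1)
    (v : Fin n → Fin n → ℝ) (hv : ∀ j l, G.Adj j l → v l j = -v j l) :
    ∃ S : Fin n → ℝ, ∃ u : Fin n → Fin n → ℝ,
      (∀ j l, G.Adj j l → u l j = -u j l) ∧
      (∀ j : Fin n,
        ∑ l : Fin n, (if G.Adj j l then Real.sqrt (ω j l) * u j l * ((ρ j + ρ l) / 2) else 0)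
          = 0) ∧
      (∀ j l, G.Adj j l → v j l = Real.sqrt (ω j l) * (S j - S l) + u j l) ∧
      (∀ S' : Fin n → ℝ, ∀ u' : Fin n → Fin n → ℝ,
        (∀ j : Fin n,
          ∑ l : Fin n, (if G.Adj j l then Real.sqrt (ω j l) * u' j l * ((ρ j + ρ l) / 2) else 0)
            = 0) →
        (∀ j l, G.Adj j l → v j l = Real.sqrt (ω j l) * (S' j - S' l) + u' j l) →
        ∃ c : ℝ, ∀ j, S' j = S j + c) := by
  let c : Fin n → Fin n → ℝ := fun j l =>
    if G.Adj j l then ω j l * ((ρ j + ρ l) / 2) else 0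
  let b : Fin n → ℝ := fun j =>
    ∑ l, if G.Adj j l then Real.sqrt (ω j l) * v j l * ((ρ j + ρ l) / 2) else 0
  have hc (j l : Fin n) : c j l = c l j := by
    simp only [c, G.adj_comm j l, hω j l, add_comm (ρ j)]
  have hpos (j l : Fin n) (h : G.Adj j l) : 0 < c j l := by
    have := hωpos j l h
    have := hρpos j
    have := hρpos l
    simp only [c, if_pos h]
    positivity
  have hnonneg (j l : Fin n) : 0 ≤ c j l := by
    by_cases h : G.Adj j l
    · exact (hpos j l h).le
    · simp [c, h]
  have hb : ∑ j, b j = 0 := sum_sum_eq_zero_of_skew fun j l => by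
    by_cases h : G.Adj j l
    · rw [if_pos h, if_pos h.symm, hv j l h, hω l j]
      ring
    · rw [if_neg h, if_neg (mt SimpleGraph.Adj.symm h), neg_zero]
  have hdiv (S : Fin n → ℝ) (u : Fin n → Fin n → ℝ)
      (hdecomp : ∀ j l, G.Adj j l → v j l = Real.sqrt (ω j l) * (S j - S l) + u j l)
      (j : Fin n) :
      b j = weightedLaplacian c S j + ∑ l : Fin n,
        (if G.Adj j l then Real.sqrt (ω j l) * u j l * ((ρ j + ρ l) / 2) else 0) := by
    rw [weightedLaplacian_apply, ← sum_add_distrib]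
    refine sum_congr rfl fun l _ => ?_
    by_cases h : G.Adj j l
    · simp only [c, if_pos h]
      rw [hdecomp j l h]
      linear_combination (S j - S l) * ((ρ j + ρ l) / 2) * Real.mul_self_sqrt (hωpos j l h).le
    · simp [c, h]
  obtain ⟨S, hS⟩ := exists_weightedLaplacian_eq hconn hc hnonneg hpos hb
  have hdecomp (j l : Fin n) (_ : G.Adj j l) : v j l = Real.sqrt (ω j l) * (S j - S l) +
      (v j l - Real.sqrt (ω j l) * (S j - S l)) := by ring
  refine ⟨S, fun j l => v j l - Real.sqrt (ω j l) * (S j - S l), fun j l h => ?_, fun j => ?_,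
    hdecomp, fun S' u' hu' hdecomp' => ?_⟩
  · beta_reduce
    rw [hv j l h, hω l j]
    ring
  · have h := hdiv S _ hdecomp j
    rwa [hS, left_eq_add] at h
  · have hS' : weightedLaplacian c S' = b := by
      ext j
      rw [hdiv S' u' hdecomp' j, hu' j, add_zero]
    have hker : weightedLaplacian c (S' - S) = 0 := by rw [map_sub, hS', hS, sub_self]
    obtain ⟨i⟩ := hconn.nonempty
    refine ⟨S' i - S i, fun j => ?_⟩
    have h := eq_of_weightedLaplacian_eq_zero hconn hc hnonneg hpos hker j i
    simp only [Pi.sub_apply] at h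
    linarith
end

section
/- On a finite, connected weighted graph G, the discrete Fisher information blows up at the boundary of the probability simplex: for every M > 0 there exists c > 0 such that every ρ ∈ P_o(G) with I(ρ) ≤ M satisfies min_{j} ρ_j ≥ c. Equivalently, for any sequence ρ^{(m)} ∈ P_o(G) with min_j ρ^{(m)}_j → 0, one has I(ρ^{(m)}) → +∞. -/
open Finset

/-- The discrete Fisher information
`I(ρ) = (1/2)·Σ_{(j,l)∈E} ω_{jl}·(log ρ_j − log ρ_l)²·g_{jl}(ρ)`, `g_{jl}(ρ) = (ρ_j+ρ_l)/2`. -/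
noncomputable def fisherInfo {n : ℕ} (G : SimpleGraph (Fin n)) [DecidableRel G.Adj]
    (ω : Fin n → Fin n → ℝ) (ρ : Fin n → ℝ) : ℝ :=
  (1 / 2) * ∑ j : Fin n, ∑ l : Fin n,
    (if G.Adj j l then
      ω j l * (Real.log (ρ j) - Real.log (ρ l)) ^ 2 * ((ρ j + ρ l) / 2) else 0)

/-- Each edge term is bounded by twice the Fisher information. -/
theorem edge_term_le_two_mul_fisherInfo {n : ℕ} {G : SimpleGraph (Fin n)} [DecidableRel G.Adj]
    {ω : Fin n → Fin n → ℝ} (hωpos : ∀ j l, G.Adj j l → 0 < ω j l)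
    {ρ : Fin n → ℝ} (hρ : ∀ j, 0 < ρ j) {j l : Fin n} (hjl : G.Adj j l) :
    ω j l * (Real.log (ρ j) - Real.log (ρ l)) ^ 2 * ((ρ j + ρ l) / 2)
      ≤ 2 * fisherInfo G ω ρ := by
  set t : Fin n → Fin n → ℝ := fun a b => if G.Adj a b then
    ω a b * (Real.log (ρ a) - Real.log (ρ b)) ^ 2 * ((ρ a + ρ b) / 2) else 0 with ht
  have t_nonneg : ∀ a b, 0 ≤ t a b := by
    intro a b
    by_cases h : G.Adj a b
    · have := hωpos a b h
      have := hρ a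
      have := hρ b
      simp only [ht, if_pos h]
      positivity
    · simp [ht, h]
  have h_inner : t j l ≤ ∑ b, t j b :=
    single_le_sum (fun b _ => t_nonneg j b) (mem_univ l)
  have h_outer : ∑ b, t j b ≤ ∑ a, ∑ b, t a b :=
    single_le_sum (f := fun a => ∑ b, t a b)
      (fun a _ => sum_nonneg fun b _ => t_nonneg a b) (mem_univ j)
  have h_info : fisherInfo G ω ρ = 1 / 2 * ∑ a, ∑ b, t a b := rfl
  have h_term : t j l = ω j l * (Real.log (ρ j) - Real.log (ρ l)) ^ 2 * ((ρ j + ρ l) / 2) :=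
    if_pos hjl
  linarith

/-- If the Fisher information is at most `M`, a lower bound `b` at a vertex yields an explicit
lower bound at each neighbour. -/
theorem le_of_adj_of_fisherInfo_le {n : ℕ} {G : SimpleGraph (Fin n)} [DecidableRel G.Adj]
    {ω : Fin n → Fin n → ℝ} (hωpos : ∀ j l, G.Adj j l → 0 < ω j l)
    {ρ : Fin n → ℝ} (hρ : ∀ j, 0 < ρ j) {M : ℝ} (hM : fisherInfo G ω ρ ≤ M)
    {j l : Fin n} (hjl : G.Adj j l) {b : ℝ} (hb : 0 < b) (hbj : b ≤ ρ j) :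
    b * Real.exp (-√(4 * M / (ω j l * b))) ≤ ρ l := by
  have h_term := edge_term_le_two_mul_fisherInfo hωpos hρ hjl
  have hω := hωpos j l hjl
  have hl := hρ l
  have h_sq : (Real.log (ρ j) - Real.log (ρ l)) ^ 2 ≤ 4 * M / (ω j l * b) := by
    rw [le_div_iff₀ (by positivity)]
    have h_weight : ω j l * (Real.log (ρ j) - Real.log (ρ l)) ^ 2 * (b / 2)
        ≤ ω j l * (Real.log (ρ j) - Real.log (ρ l)) ^ 2 * ((ρ j + ρ l) / 2) := by
      gcongr
      linarith
    linarith
  have h_log := Real.le_sqrt_of_sq_le h_sq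
  calc b * Real.exp (-√(4 * M / (ω j l * b)))
      ≤ ρ j * Real.exp (-(Real.log (ρ j) - Real.log (ρ l))) := by
        gcongr
        exact (hρ j).le
    _ = ρ l := by
      rw [neg_sub, Real.exp_sub, Real.exp_log hl, Real.exp_log (hρ j),
        mul_div_cancel₀ _ (hρ j).ne']

/-- A lower bound at `u` propagates along a walk, uniformly over all densities whose Fisher
information is at most `M`. -/
theorem exists_le_of_walk_of_fisherInfo_le {n : ℕ} {G : SimpleGraph (Fin n)}
    [DecidableRel G.Adj] {ω : Fin n → Fin n → ℝ} (hωpos : ∀ j l, G.Adj j l → 0 < ω j l)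
    (M : ℝ) {u v : Fin n} (p : G.Walk u v) {b : ℝ} (hb : 0 < b) :
    ∃ c > 0, ∀ ρ : Fin n → ℝ,
      (∀ j, 0 < ρ j) → fisherInfo G ω ρ ≤ M → b ≤ ρ u → c ≤ ρ v := by
  induction p generalizing b with
  | nil => exact ⟨b, hb, fun _ _ _ h => h⟩
  | cons hadj _ ih =>
    obtain ⟨c, hc, h⟩ := ih (mul_pos hb (Real.exp_pos _))
    exact ⟨c, hc, fun ρ hρ hM hbu =>
      h ρ hρ hM (le_of_adj_of_fisherInfo_le hωpos hρ hM hadj hb hbu)⟩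

/-- boundary blow-up of the Fisher information: on a finite connected
weighted graph, for every `M > 0` there is `c > 0` such that every `ρ` in the interior of
the probability simplex with `I(ρ) ≤ M` satisfies `min_j ρ_j ≥ c`. -/
theorem fisherInfo_boundary_blowup {n : ℕ}
    (G : SimpleGraph (Fin n)) [DecidableRel G.Adj] (hconn : G.Connected)
    (ω : Fin n → Fin n → ℝ) (hω : ∀ j l, ω j l = ω l j)
    (hωpos : ∀ j l, G.Adj j l → 0 < ω j l) :
    ∀ M > (0 : ℝ), ∃ c > (0 : ℝ), ∀ ρ : Fin n → ℝ,
      (∀ j, 0 < ρ j) → ∑ j, ρ j = 1 → fisherInfo G ω ρ ≤ M → ∀ j, c ≤ ρ j := by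
  intro M _
  have := hconn.nonempty
  have hn : (0 : ℝ) < n := by exact_mod_cast Fin.pos_iff_nonempty.mpr this
  have h_pair : ∀ q : Fin n × Fin n, ∃ c > 0, ∀ ρ : Fin n → ℝ,
      (∀ j, 0 < ρ j) → fisherInfo G ω ρ ≤ M → 1 / (n : ℝ) ≤ ρ q.1 → c ≤ ρ q.2 := fun q =>
    exists_le_of_walk_of_fisherInfo_le hωpos M (hconn.preconnected q.1 q.2).some
      (one_div_pos.mpr hn)
  choose c hc h_le using h_pair
  obtain ⟨q, hq⟩ := Finite.exists_min c
  refine ⟨c q, hc q, fun ρ hρ h_sum hM j => ?_⟩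
  obtain ⟨u, -, hu⟩ : ∃ u ∈ (univ : Finset (Fin n)), 1 / (n : ℝ) ≤ ρ u := by
    refine exists_le_of_sum_le univ_nonempty ?_
    simp [h_sum, hn.ne']
  exact (hq (u, j)).trans (h_le (u, j) ρ hρ hM hu)
end

section
/- On a finite, connected weighted graph G, for every M > 0 the sublevel set B = {ρ ∈ P_o(G) : I(ρ) ≤ M} of the discrete Fisher information is a compact subset of ℝⁿ that is contained in the open simplex P_o(G) (i.e. it stays uniformly away from the boundary where some coordinate vanishes). -/
open Finset

theorem fisherInfo_edge_le {n : ℕ} {G : SimpleGraph (Fin n)} [DecidableRel G.Adj]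
    {ω : Fin n → Fin n → ℝ} (hωpos : ∀ j l, G.Adj j l → 0 < ω j l)
    {ρ : Fin n → ℝ} (hρ : ∀ j, 0 < ρ j) {j l : Fin n} (h : G.Adj j l) :
    ω j l * (Real.log (ρ j) - Real.log (ρ l)) ^ 2 * ((ρ j + ρ l) / 2) ≤
      2 * fisherInfo G ω ρ := by
  have hnn : ∀ a b : Fin n, 0 ≤ (if G.Adj a b then
      ω a b * (Real.log (ρ a) - Real.log (ρ b)) ^ 2 * ((ρ a + ρ b) / 2) else 0) := by
    intro a b
    split_ifs with hab
    · have := hωpos a b hab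
      have := hρ a
      have := hρ b
      positivity
    · exact le_rfl
  have h_row := Finset.single_le_sum (fun b _ => hnn j b) (Finset.mem_univ l)
  have h_total := Finset.single_le_sum
    (fun a _ => Finset.sum_nonneg fun b (_ : b ∈ Finset.univ) => hnn a b) (Finset.mem_univ j)
  rw [if_pos h] at h_row
  unfold fisherInfo
  linarith

theorem exists_lower_bound_of_adj {n : ℕ} {G : SimpleGraph (Fin n)} [DecidableRel G.Adj]
    {ω : Fin n → Fin n → ℝ} (hωpos : ∀ j l, G.Adj j l → 0 < ω j l) (M : ℝ)
    {j l : Fin n} (h : G.Adj j l) {a : ℝ} (ha : 0 < a) :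
    ∃ b > 0, ∀ ρ : Fin n → ℝ, (∀ i, 0 < ρ i) → fisherInfo G ω ρ ≤ M → a ≤ ρ j → b ≤ ρ l := by
  have hω := hωpos j l h
  refine ⟨a * Real.exp (-√(4 * M / (ω j l * a))), by positivity, fun ρ hρ hM haj => ?_⟩
  have h_edge := fisherInfo_edge_le hωpos hρ h
  have hl := hρ l
  have h_sq : (Real.log (ρ j) - Real.log (ρ l)) ^ 2 ≤ 4 * M / (ω j l * a) := by
    rw [le_div_iff₀ (by positivity)]
    have : ω j l * (Real.log (ρ j) - Real.log (ρ l)) ^ 2 * (a / 2) ≤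
        ω j l * (Real.log (ρ j) - Real.log (ρ l)) ^ 2 * ((ρ j + ρ l) / 2) := by
      gcongr
      linarith
    linarith
  have h_log := (le_abs_self _).trans (Real.abs_le_sqrt h_sq)
  have h_mono := Real.log_le_log ha haj
  rw [← Real.log_le_log_iff (by positivity) hl, Real.log_mul ha.ne' (Real.exp_ne_zero _),
    Real.log_exp]
  linarith

theorem exists_lower_bound_of_walk {n : ℕ} {G : SimpleGraph (Fin n)} [DecidableRel G.Adj]
    {ω : Fin n → Fin n → ℝ} (hωpos : ∀ j l, G.Adj j l → 0 < ω j l) (M : ℝ)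
    {j l : Fin n} (p : G.Walk j l) {a : ℝ} (ha : 0 < a) :
    ∃ b > 0, ∀ ρ : Fin n → ℝ, (∀ i, 0 < ρ i) → fisherInfo G ω ρ ≤ M → a ≤ ρ j → b ≤ ρ l := by
  induction p generalizing a with
  | nil => exact ⟨a, ha, fun _ _ _ h => h⟩
  | cons h _ ih =>
    obtain ⟨b, hb, hab⟩ := exists_lower_bound_of_adj hωpos M h ha
    obtain ⟨c, hc, hbc⟩ := ih hb
    exact ⟨c, hc, fun ρ hρ hM haj => hbc ρ hρ hM (hab ρ hρ hM haj)⟩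

open Filter Topology in
theorem exists_uniform_lower_bound {n : ℕ} {G : SimpleGraph (Fin n)} [DecidableRel G.Adj]
    (hconn : G.Connected) {ω : Fin n → Fin n → ℝ} (hωpos : ∀ j l, G.Adj j l → 0 < ω j l)
    (M : ℝ) :
    ∃ c > 0, ∀ ρ : Fin n → ℝ, (∀ i, 0 < ρ i) → ∑ i, ρ i = 1 → fisherInfo G ω ρ ≤ M →
      ∀ l, c ≤ ρ l := by
  have : Nonempty (Fin n) := hconn.nonempty
  have hn : (0 : ℝ) < n := by exact_mod_cast Fin.pos_iff_nonempty.mpr this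
  choose b hb hbound using fun j l =>
    exists_lower_bound_of_walk hωpos M (hconn.preconnected j l).some (one_div_pos.mpr hn)
  have h_small : ∀ᶠ c in 𝓝[>] (0 : ℝ), ∀ j l, c ≤ b j l :=
    eventually_all.mpr fun j => eventually_all.mpr fun l =>
      nhdsWithin_le_nhds ((eventually_lt_nhds (hb j l)).mono fun _ => le_of_lt)
  obtain ⟨c, hcb, hc⟩ := (h_small.and self_mem_nhdsWithin).exists
  refine ⟨c, hc, fun ρ hρ h_sum hM l => ?_⟩
  obtain ⟨j, -, hj⟩ : ∃ j ∈ Finset.univ, 1 / (n : ℝ) ≤ ρ j :=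
    Finset.exists_le_of_sum_le Finset.univ_nonempty (by simp [h_sum, hn.ne'])
  exact (hcb j l).trans (hbound j l ρ hρ hM hj)

theorem continuousOn_fisherInfo {n : ℕ} (G : SimpleGraph (Fin n)) [DecidableRel G.Adj]
    (ω : Fin n → Fin n → ℝ) : ContinuousOn (fisherInfo G ω) {ρ | ∀ j, 0 < ρ j} := by
  have h_log (j : Fin n) :
      ContinuousOn (fun ρ : Fin n → ℝ => Real.log (ρ j)) {ρ | ∀ j, 0 < ρ j} :=
    (continuous_apply j).continuousOn.log fun _ hρ => (hρ j).ne'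
  unfold fisherInfo
  refine continuousOn_const.mul (continuousOn_finsetSum _ fun j _ =>
    continuousOn_finsetSum _ fun l _ => ?_)
  split_ifs
  · exact (continuousOn_const.mul (((h_log j).sub (h_log l)).pow 2)).mul (by fun_prop)
  · exact continuousOn_const

/-- compactness of Fisher sublevel sets: on a finite connected weighted
graph, for every `M > 0`, the sublevel set `B = {ρ ∈ P_o(G) : I(ρ) ≤ M}` is a compact
subset of `ℝⁿ` contained in the open simplex `P_o(G)`. -/
theorem fisherInfo_sublevel_compact {n : ℕ}
    (G : SimpleGraph (Fin n)) [DecidableRel G.Adj] (hconn : G.Connected)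
    (ω : Fin n → Fin n → ℝ) (hω : ∀ j l, ω j l = ω l j)
    (hωpos : ∀ j l, G.Adj j l → 0 < ω j l)
    (M : ℝ) (hM : 0 < M) :
    IsCompact {ρ : Fin n → ℝ |
        (∀ j, 0 < ρ j) ∧ (∑ j, ρ j = 1) ∧ fisherInfo G ω ρ ≤ M} ∧
    {ρ : Fin n → ℝ | (∀ j, 0 < ρ j) ∧ (∑ j, ρ j = 1) ∧ fisherInfo G ω ρ ≤ M} ⊆
      {ρ : Fin n → ℝ | (∀ j, 0 < ρ j) ∧ ∑ j, ρ j = 1} := by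
  refine ⟨?_, fun ρ hρ => ⟨hρ.1, hρ.2.1⟩⟩
  obtain ⟨c, hc, hbound⟩ := exists_uniform_lower_bound hconn hωpos M
  have hK : IsCompact (stdSimplex ℝ (Fin n) ∩ Set.Ici fun _ => c) :=
    (isCompact_stdSimplex ℝ (Fin n)).inter_right isClosed_Ici
  have h_pos : (stdSimplex ℝ (Fin n) ∩ Set.Ici fun _ => c) ⊆ {ρ | ∀ j, 0 < ρ j} :=
    fun _ hρ j => hc.trans_le (hρ.2 j)
  have h_closed := ((continuousOn_fisherInfo G ω).mono h_pos).preimage_isClosed_of_isClosed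
    hK.isClosed (isClosed_Iic (a := M))
  convert hK.of_isClosed_subset h_closed Set.inter_subset_left using 1
  ext ρ
  constructor
  · rintro ⟨hρ, h_sum, hM⟩
    exact ⟨⟨⟨fun j => (hρ j).le, h_sum⟩, hbound ρ hρ h_sum hM⟩, hM⟩
  · rintro ⟨hρ, hM⟩
    exact ⟨h_pos hρ, hρ.1.2, hM⟩
end

section
/- Stationary solutions determine the energy level: let G be a finite, connected weighted graph, h > 0, 𝕍 ∈ ℝⁿ, 𝕎 ∈ ℝ^{n×n} symmetric, and define F(ρ) = (h²/8)I(ρ) + V(ρ) + W(ρ) on the open simplex. Suppose ρ* ∈ P_o(G) and ν ∈ ℝ satisfy the stationarity condition ν = (∂F/∂ρ_j)(ρ*) for every node j (i.e. ρ* is a critical point of F on the simplex with Lagrange multiplier ν). Then ν = E(√ρ*) + E_int(√ρ*), where E(√ρ) = (h²/8)I(ρ) + V(ρ) + W(ρ) and E_int(√ρ) = W(ρ). -/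
open Finset

/-- Linear potential energy `V(ρ) = Σ_j 𝕍_j ρ_j`. -/
noncomputable def potV {n : ℕ} (V : Fin n → ℝ) (ρ : Fin n → ℝ) : ℝ := ∑ j : Fin n, V j * ρ j

/-- Interaction potential energy `W(ρ) = (1/2)·Σ_{j,l} 𝕎_{jl} ρ_j ρ_l`. -/
noncomputable def potW {n : ℕ} (W : Fin n → Fin n → ℝ) (ρ : Fin n → ℝ) : ℝ :=
  (1 / 2) * ∑ j : Fin n, ∑ l : Fin n, W j l * ρ j * ρ l

/-- The partial derivative `∂f/∂ρ_j` of a function on `ℝⁿ`. -/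
noncomputable def pderiv {n : ℕ} (f : (Fin n → ℝ) → ℝ) (ρ : Fin n → ℝ) (j : Fin n) : ℝ :=
  deriv (fun x : ℝ => f (Function.update ρ j x)) (ρ j)

theorem pderiv_eq_fderiv_single {n : ℕ} {f : (Fin n → ℝ) → ℝ} {ρ : Fin n → ℝ}
    (hf : DifferentiableAt ℝ f ρ) (j : Fin n) :
    pderiv f ρ j = fderiv ℝ f ρ (Pi.single j 1) := by
  have hf' : HasFDerivAt f (fderiv ℝ f ρ) (Function.update ρ j (ρ j)) := by
    simpa using hf.hasFDerivAt
  exact (hf'.comp_hasDerivAt (ρ j) (hasDerivAt_update ρ j (ρ j))).deriv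

/-- The Euler operator `Σ_j ρ_j ∂f/∂ρ_j` is the radial derivative of `f`. -/
theorem sum_mul_pderiv_eq_of_hasDerivAt {n : ℕ} {f : (Fin n → ℝ) → ℝ} {ρ : Fin n → ℝ}
    (hf : DifferentiableAt ℝ f ρ) {f' : ℝ}
    (hray : HasDerivAt (fun t : ℝ => f (t • ρ)) f' 1) :
    ∑ j, ρ j * pderiv f ρ j = f' := by
  have hf' : HasFDerivAt f (fderiv ℝ f ρ) ((1 : ℝ) • ρ) := by
    simpa using hf.hasFDerivAt
  have hsmul : HasDerivAt (fun t : ℝ => t • ρ) ρ 1 := by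
    simpa using (hasDerivAt_id (1 : ℝ)).smul_const ρ
  rw [hray.unique (hf'.comp_hasDerivAt (1 : ℝ) hsmul)]
  have hexpand : ρ = ∑ j, ρ j • Pi.single j (1 : ℝ) := by
    simpa using pi_eq_sum_univ' ρ
  have hmap := congrArg (fderiv ℝ f ρ) hexpand
  rw [map_sum] at hmap
  simpa only [pderiv_eq_fderiv_single hf, map_smul, smul_eq_mul] using hmap.symm

theorem differentiableAt_fisherInfo {n : ℕ} (G : SimpleGraph (Fin n)) [DecidableRel G.Adj]
    (ω : Fin n → Fin n → ℝ) {ρ : Fin n → ℝ} (hρ : ∀ j, ρ j ≠ 0) :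
    DifferentiableAt ℝ (fisherInfo G ω) ρ := by
  unfold fisherInfo
  refine DifferentiableAt.const_mul (DifferentiableAt.fun_sum fun j _ =>
    DifferentiableAt.fun_sum fun l _ => ?_) _
  split_ifs
  · have hj := hρ j
    have hl := hρ l
    fun_prop (disch := assumption)
  · fun_prop

theorem differentiable_potV {n : ℕ} (V : Fin n → ℝ) : Differentiable ℝ (potV V) := by
  unfold potV
  fun_prop

theorem differentiable_potW {n : ℕ} (W : Fin n → Fin n → ℝ) : Differentiable ℝ (potW W) := by
  unfold potW
  fun_prop

theorem fisherInfo_smul {n : ℕ} (G : SimpleGraph (Fin n)) [DecidableRel G.Adj]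
    (ω : Fin n → Fin n → ℝ) {ρ : Fin n → ℝ} (hρ : ∀ j, ρ j ≠ 0) {t : ℝ} (ht : t ≠ 0) :
    fisherInfo G ω (t • ρ) = t * fisherInfo G ω ρ := by
  simp only [fisherInfo, Finset.mul_sum, Pi.smul_apply, smul_eq_mul]
  refine Finset.sum_congr rfl fun j _ => Finset.sum_congr rfl fun l _ => ?_
  split_ifs
  · rw [Real.log_mul ht (hρ j), Real.log_mul ht (hρ l)]
    ring
  · ring

theorem potV_smul {n : ℕ} (V ρ : Fin n → ℝ) (t : ℝ) : potV V (t • ρ) = t * potV V ρ := by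
  simp only [potV, Finset.mul_sum, Pi.smul_apply, smul_eq_mul]
  exact Finset.sum_congr rfl fun j _ => by ring

theorem potW_smul {n : ℕ} (W : Fin n → Fin n → ℝ) (ρ : Fin n → ℝ) (t : ℝ) :
    potW W (t • ρ) = t ^ 2 * potW W ρ := by
  simp only [potW, Finset.mul_sum, Pi.smul_apply, smul_eq_mul]
  exact Finset.sum_congr rfl fun j _ => Finset.sum_congr rfl fun l _ => by ring

/-- energy level of a stationary solution: if `ρ* ∈ P_o(G)` is a critical
point of `F(ρ) = (h²/8)I(ρ) + V(ρ) + W(ρ)` on the simplex with Lagrange multiplier `ν`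
(i.e. `∂F/∂ρ_j(ρ*) = ν` for all `j`), then `ν = E(√ρ*) + E_int(√ρ*)`, i.e.
`ν = F(ρ*) + W(ρ*)`. -/
theorem nls_stationary_energy_level {n : ℕ}
    (G : SimpleGraph (Fin n)) [DecidableRel G.Adj] (hconn : G.Connected)
    (ω : Fin n → Fin n → ℝ) (hω : ∀ j l, ω j l = ω l j)
    (hωpos : ∀ j l, G.Adj j l → 0 < ω j l)
    (h : ℝ) (hh : 0 < h) (V : Fin n → ℝ) (W : Fin n → Fin n → ℝ)
    (hW : ∀ j l, W j l = W l j)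
    (ρstar : Fin n → ℝ) (hpos : ∀ j, 0 < ρstar j) (hsum : ∑ j, ρstar j = 1)
    (ν : ℝ)
    (hcrit : ∀ j : Fin n,
      pderiv (fun σ => (h ^ 2 / 8) * fisherInfo G ω σ + potV V σ + potW W σ) ρstar j = ν) :
    ν = ((h ^ 2 / 8) * fisherInfo G ω ρstar + potV V ρstar + potW W ρstar)
        + potW W ρstar := by
  have hne : ∀ j, ρstar j ≠ 0 := fun j => (hpos j).ne'
  have hdiff : DifferentiableAt ℝ
      (fun σ => (h ^ 2 / 8) * fisherInfo G ω σ + potV V σ + potW W σ) ρstar :=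
    (((differentiableAt_fisherInfo G ω hne).const_mul _).add
      (differentiable_potV V ρstar)).add (differentiable_potW W ρstar)
  have hpoly : HasDerivAt
      (fun t : ℝ => t * ((h ^ 2 / 8) * fisherInfo G ω ρstar + potV V ρstar)
        + t ^ 2 * potW W ρstar)
      (((h ^ 2 / 8) * fisherInfo G ω ρstar + potV V ρstar + potW W ρstar)
        + potW W ρstar) 1 := by
    refine (((hasDerivAt_id (1 : ℝ)).mul_const _).add
      ((hasDerivAt_pow 2 (1 : ℝ)).mul_const _)).congr_deriv ?_
    norm_num
    ring
  have hray : HasDerivAt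
      (fun t : ℝ => (h ^ 2 / 8) * fisherInfo G ω (t • ρstar) + potV V (t • ρstar)
        + potW W (t • ρstar))
      (((h ^ 2 / 8) * fisherInfo G ω ρstar + potV V ρstar + potW W ρstar)
        + potW W ρstar) 1 := by
    refine hpoly.congr_of_eventuallyEq ?_
    filter_upwards [eventually_ne_nhds (one_ne_zero (α := ℝ))] with t ht
    rw [fisherInfo_smul G ω hne ht, potV_smul, potW_smul]
    ring
  rw [← sum_mul_pderiv_eq_of_hasDerivAt hdiff hray]
  simp only [hcrit, ← Finset.sum_mul, hsum, one_mul]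
end

section
/- Hessian quadratic-form identity for the discrete Fisher information: let G be a finite, undirected simple weighted graph and ρ ∈ ℝⁿ with ρ_j > 0 for all j. Then for every σ ∈ ℝⁿ, σᵀ·Hess I(ρ)·σ = (1/2)·Σ_{(j,l)∈E} ω_{jl}·t_{jl}·(σ_j/ρ_j − σ_l/ρ_l)², where t_{jl} = (ρ_j − ρ_l)(log ρ_j − log ρ_l) + (ρ_j + ρ_l) > 0. In particular the Hessian of I is positive semidefinite, so I is convex on the positive orthant. -/
open Finset

/-- The weight `t_{jl}` is positive. -/
theorem sub_mul_log_sub_log_add_pos {a b : ℝ} (ha : 0 < a) (hb : 0 < b) :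
    0 < (a - b) * (Real.log a - Real.log b) + (a + b) := by
  have h : 0 ≤ (a - b) * (Real.log a - Real.log b) := by
    rcases le_total a b with hab | hab
    · exact mul_nonneg_of_nonpos_of_nonpos (sub_nonpos.2 hab)
        (sub_nonpos.2 (Real.log_le_log ha hab))
    · exact mul_nonneg (sub_nonneg.2 hab) (sub_nonneg.2 (Real.log_le_log hb hab))
  linarith

/-- Derivative of the edge term of the Fisher information in direction `(u, v)`. -/
noncomputable def edgeDeriv (a b u v : ℝ) : ℝ :=
  (Real.log a - Real.log b) * (u / a - v / b) * (a + b) +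
    (Real.log a - Real.log b) ^ 2 * ((u + v) / 2)

theorem hasDerivAt_add_mul_const (a u t : ℝ) : HasDerivAt (fun s : ℝ => a + s * u) u t := by
  simpa using ((hasDerivAt_id t).mul_const u).const_add a

theorem hasDerivAt_edge {a b u v t : ℝ} (ha : 0 < a + t * u) (hb : 0 < b + t * v) :
    HasDerivAt
      (fun s : ℝ => (Real.log (a + s * u) - Real.log (b + s * v)) ^ 2 *
        ((a + s * u + (b + s * v)) / 2))
      (edgeDeriv (a + t * u) (b + t * v) u v) t := by
  have hA := hasDerivAt_add_mul_const a u t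
  have hB := hasDerivAt_add_mul_const b v t
  have hL := (hA.log ha.ne').sub (hB.log hb.ne')
  refine ((hL.pow 2).mul ((hA.add hB).div_const 2)).congr_deriv ?_
  simp only [edgeDeriv, Pi.add_apply, Pi.sub_apply, Pi.pow_apply]
  push_cast
  ring

theorem hasDerivAt_edgeDeriv {a b u v t : ℝ} (ha : 0 < a + t * u) (hb : 0 < b + t * v) :
    HasDerivAt
      (fun s : ℝ => edgeDeriv (a + s * u) (b + s * v) u v)
      (((a + t * u - (b + t * v)) * (Real.log (a + t * u) - Real.log (b + t * v)) +
        (a + t * u + (b + t * v))) * (u / (a + t * u) - v / (b + t * v)) ^ 2) t := by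
  have hA := hasDerivAt_add_mul_const a u t
  have hB := hasDerivAt_add_mul_const b v t
  have hL := (hA.log ha.ne').sub (hB.log hb.ne')
  have hP := ((hasDerivAt_const t u).div hA ha.ne').sub ((hasDerivAt_const t v).div hB hb.ne')
  refine (((hL.mul hP).mul (hA.add hB)).add ((hL.pow 2).mul_const ((u + v) / 2))).congr_deriv ?_
  simp only [Pi.add_apply, Pi.sub_apply, Pi.mul_apply, Pi.div_apply]
  generalize a + t * u = x at *
  generalize b + t * v = y at *
  have hx := ha.ne'
  have hy := hb.ne'
  push_cast
  field_simp
  ring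

section Line

variable {n : ℕ} (G : SimpleGraph (Fin n)) [DecidableRel G.Adj] (ω : Fin n → Fin n → ℝ)

/-- Derivative of the Fisher information at `ρ` in direction `σ`. -/
noncomputable def fisherInfoDeriv (ρ σ : Fin n → ℝ) : ℝ :=
  (1 / 2) * ∑ j : Fin n, ∑ l : Fin n,
    (if G.Adj j l then ω j l * edgeDeriv (ρ j) (ρ l) (σ j) (σ l) else 0)

/-- Hessian quadratic form of the Fisher information at `ρ` in direction `σ`. -/
noncomputable def fisherInfoHess (ρ σ : Fin n → ℝ) : ℝ :=
  (1 / 2) * ∑ j : Fin n, ∑ l : Fin n,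
    (if G.Adj j l then
      ω j l * ((ρ j - ρ l) * (Real.log (ρ j) - Real.log (ρ l)) + (ρ j + ρ l))
        * (σ j / ρ j - σ l / ρ l) ^ 2 else 0)

theorem hasDerivAt_fisherInfo_line {ρ σ : Fin n → ℝ} {t : ℝ} (h : ∀ j, 0 < ρ j + t * σ j) :
    HasDerivAt (fun s : ℝ => fisherInfo G ω (fun j => ρ j + s * σ j))
      (fisherInfoDeriv G ω (fun j => ρ j + t * σ j) σ) t := by
  unfold fisherInfo fisherInfoDeriv
  refine (HasDerivAt.fun_sum fun j _ => HasDerivAt.fun_sum fun l _ => ?_).const_mul _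
  split_ifs
  · simpa only [mul_assoc] using (hasDerivAt_edge (h j) (h l)).const_mul (ω j l)
  · exact hasDerivAt_const t 0

theorem hasDerivAt_fisherInfoDeriv_line {ρ σ : Fin n → ℝ} {t : ℝ}
    (h : ∀ j, 0 < ρ j + t * σ j) :
    HasDerivAt (fun s : ℝ => fisherInfoDeriv G ω (fun j => ρ j + s * σ j) σ)
      (fisherInfoHess G ω (fun j => ρ j + t * σ j) σ) t := by
  unfold fisherInfoDeriv fisherInfoHess
  refine (HasDerivAt.fun_sum fun j _ => HasDerivAt.fun_sum fun l _ => ?_).const_mul _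
  split_ifs
  · simpa only [mul_assoc] using (hasDerivAt_edgeDeriv (h j) (h l)).const_mul (ω j l)
  · exact hasDerivAt_const t 0

theorem iteratedDeriv_two_fisherInfo_line {ρ : Fin n → ℝ} (hρ : ∀ j, 0 < ρ j)
    (σ : Fin n → ℝ) :
    iteratedDeriv 2 (fun t : ℝ => fisherInfo G ω (fun j => ρ j + t * σ j)) 0 =
      fisherInfoHess G ω ρ σ := by
  have hev : ∀ᶠ t : ℝ in nhds 0, ∀ j, 0 < ρ j + t * σ j := by
    refine Filter.eventually_all.2 fun j => ?_
    have hc : Continuous fun t : ℝ => ρ j + t * σ j := by fun_prop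
    exact hc.continuousAt.eventually_const_lt (by simpa using hρ j)
  have hd : deriv (fun t : ℝ => fisherInfo G ω (fun j => ρ j + t * σ j)) =ᶠ[nhds 0]
      fun t => fisherInfoDeriv G ω (fun j => ρ j + t * σ j) σ :=
    hev.mono fun t ht => (hasDerivAt_fisherInfo_line G ω ht).deriv
  rw [iteratedDeriv_succ, iteratedDeriv_one, hd.deriv_eq,
    (hasDerivAt_fisherInfoDeriv_line G ω hev.self_of_nhds).deriv]
  simp

variable {ω}

theorem fisherInfoHess_nonneg (hω : ∀ j l, G.Adj j l → 0 < ω j l) {ρ : Fin n → ℝ}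
    (hρ : ∀ j, 0 < ρ j) (σ : Fin n → ℝ) : 0 ≤ fisherInfoHess G ω ρ σ := by
  refine mul_nonneg (by norm_num) (sum_nonneg fun j _ => sum_nonneg fun l _ => ?_)
  split_ifs with h
  · exact mul_nonneg (mul_nonneg (hω j l h).le
      (sub_mul_log_sub_log_add_pos (hρ j) (hρ l)).le) (sq_nonneg _)
  · exact le_rfl

theorem convexOn_fisherInfo (hω : ∀ j l, G.Adj j l → 0 < ω j l) :
    ConvexOn ℝ {σ : Fin n → ℝ | ∀ j, 0 < σ j} (fisherInfo G ω) := by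
  have hconv : Convex ℝ {σ : Fin n → ℝ | ∀ j, 0 < σ j} := fun x hx y hy a b ha hb hab j =>
    convex_Ioi (0 : ℝ) (hx j) (hy j) ha hb hab
  refine ⟨hconv, fun x hx y hy a b ha hb hab => ?_⟩
  have hpos : ∀ t ∈ Set.Icc (0 : ℝ) 1, ∀ j, 0 < x j + t * (y - x) j := fun t ht j => by
    have h := hconv.add_smul_sub_mem hx hy ht j
    simpa using h
  have hline : ConvexOn ℝ (Set.Icc (0 : ℝ) 1)
      fun t : ℝ => fisherInfo G ω (fun j => x j + t * (y - x) j) := by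
    refine convexOn_of_hasDerivWithinAt2_nonneg (convex_Icc 0 1)
      (fun t ht => (hasDerivAt_fisherInfo_line G ω (hpos t ht)).continuousAt.continuousWithinAt)
      (fun t ht => (hasDerivAt_fisherInfo_line G ω
        (hpos t (interior_subset ht))).hasDerivWithinAt)
      (fun t ht => (hasDerivAt_fisherInfoDeriv_line G ω
        (hpos t (interior_subset ht))).hasDerivWithinAt)
      (fun t ht => fisherInfoHess_nonneg G hω (hpos t (interior_subset ht)) _)
  have h := hline.2 (Set.left_mem_Icc.2 zero_le_one) (Set.right_mem_Icc.2 zero_le_one) ha hb hab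
  have hcomb : (fun j => x j + b * (y - x) j) = a • x + b • y := by
    funext j
    simp only [Pi.sub_apply, Pi.add_apply, Pi.smul_apply, smul_eq_mul]
    linear_combination (-x j) * hab
  have hright : (fun j => x j + 1 * (y - x) j) = y := by
    funext j
    simp
  have hleft : (fun j => x j + 0 * (y - x) j) = x := by
    funext j
    simp
  simpa only [smul_eq_mul, mul_zero, mul_one, zero_add, hcomb, hleft, hright] using h

end Line

/-- Hessian quadratic form of the Fisher information: on the open positive
orthant, for every direction `σ`,
`σᵀ·Hess I(ρ)·σ = (1/2)·Σ_{(j,l)∈E} ω_{jl}·t_{jl}·(σ_j/ρ_j − σ_l/ρ_l)²` with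
`t_{jl} = (ρ_j − ρ_l)(log ρ_j − log ρ_l) + ρ_j + ρ_l > 0`; in particular the Hessian is
positive semidefinite and `I` is convex on the positive orthant. (The quadratic form
`σᵀ·Hess I(ρ)·σ` is expressed as the second derivative of `t ↦ I(ρ + t·σ)` at `t = 0`.) -/
theorem fisherInfo_hessian_quadForm {n : ℕ}
    (G : SimpleGraph (Fin n)) [DecidableRel G.Adj]
    (ω : Fin n → Fin n → ℝ) (hω : ∀ j l, ω j l = ω l j)
    (hωpos : ∀ j l, G.Adj j l → 0 < ω j l)
    (ρ : Fin n → ℝ) (hρpos : ∀ j, 0 < ρ j) :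
    (∀ j l, G.Adj j l →
      0 < (ρ j - ρ l) * (Real.log (ρ j) - Real.log (ρ l)) + (ρ j + ρ l)) ∧
    (∀ σ : Fin n → ℝ,
      iteratedDeriv 2 (fun t : ℝ => fisherInfo G ω (fun j => ρ j + t * σ j)) 0 =
        (1 / 2) * ∑ j : Fin n, ∑ l : Fin n,
          (if G.Adj j l then
            ω j l * ((ρ j - ρ l) * (Real.log (ρ j) - Real.log (ρ l)) + (ρ j + ρ l))
              * (σ j / ρ j - σ l / ρ l) ^ 2 else 0)) ∧
    (∀ σ : Fin n → ℝ,
      0 ≤ iteratedDeriv 2 (fun t : ℝ => fisherInfo G ω (fun j => ρ j + t * σ j)) 0) ∧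
    ConvexOn ℝ {σ : Fin n → ℝ | ∀ j, 0 < σ j} (fisherInfo G ω) := by
  exact ⟨fun j l _ => sub_mul_log_sub_log_add_pos (hρpos j) (hρpos l),
    iteratedDeriv_two_fisherInfo_line G ω hρpos,
    fun σ => (iteratedDeriv_two_fisherInfo_line G ω hρpos σ).symm ▸
      fisherInfoHess_nonneg G hωpos hρpos σ,
    convexOn_fisherInfo G hωpos⟩
end

section
/- Eigenvalues of the linearized Hamiltonian matrix for the discrete Gross–Pitaevskii equation: let n ≥ 1, h > 0, α ∈ ℝ, and let L ∈ ℝ^{n×n} be a matrix with a real eigenpair L·v = λ·v where λ > 0 and v ∈ ℝⁿ, and assume λ²h²/4 + αλ/n ≥ 0. Define the 2n×2n block matrix H = [[0, (1/n)·L], [−α·I − (n·h²/4)·L, 0]] (viewed over ℂ), and set β = √(n²h²/4 + α·n/λ) ≥ 0. Then the vectors w⁺ = (v, i·β·v) and w⁻ = (i·v, β·v) in ℂ^{2n} satisfy H·w⁺ = +i·√(λ²h²/4 + αλ/n)·w⁺ and H·w⁻ = −i·√(λ²h²/4 + αλ/n)·w⁻; that is, ±i√(λ²h²/4 + αλ/n)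 are eigenvalues of H with the stated eigenvectors. -/
open Matrix

/-- On vectors `(a v, b v)` built from an eigenvector `v` of `A`, the off-diagonal block matrix
`[[0, r A], [-s I - t A, 0]]` acts as a `2 × 2` matrix. -/
theorem fromBlocks_zero_diag_mulVec_elim_smul {m R : Type*} [Fintype m] [DecidableEq m]
    [CommRing R] {A : Matrix m m R} {v : m → R} {l : R} (hAv : A *ᵥ v = l • v)
    (r s t a b : R) :
    fromBlocks 0 (r • A) (-(s • (1 : Matrix m m R)) - t • A) 0 *ᵥ
        Sum.elim (a • v) (b • v) =
      Sum.elim ((r * l * b) • v) ((-(s + t * l) * a) • v) := by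
  rw [fromBlocks_mulVec]
  simp only [Sum.elim_comp_inl, Sum.elim_comp_inr, zero_mulVec,
    smul_mulVec, mulVec_smul, smul_zero, zero_add, add_zero, sub_mulVec, neg_mulVec, one_mulVec,
    hAv]
  congr 1 <;> ext j <;>
    simp only [Pi.smul_apply, Pi.sub_apply, Pi.neg_apply, smul_eq_mul] <;>
    ring

/-- The eigenvalue relation for the complexification of a real matrix. -/
theorem map_ofReal_mulVec_of_mulVec_eq_smul {m : Type*} [Fintype m] {A : Matrix m m ℝ}
    {v : m → ℝ} {l : ℝ} (hAv : A *ᵥ v = l • v) :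
    A.map (fun x => (x : ℂ)) *ᵥ (fun j => (v j : ℂ)) = (l : ℂ) • fun j => (v j : ℂ) := by
  ext j
  have hj := congrArg (fun x : ℝ => (x : ℂ)) (congrFun hAv j)
  simpa [mulVec, dotProduct] using hj

/-- eigenvalues of the linearized Hamiltonian matrix for the discrete
Gross–Pitaevskii equation: if `L·v = λ·v` with `λ > 0` and `λ²h²/4 + αλ/n ≥ 0`, then for
the block Hamiltonian matrix `H = [[0, (1/n)L], [−αI − (nh²/4)L, 0]]` (over `ℂ`) and
`β = √(n²h²/4 + αn/λ)`, the vectors `w⁺ = (v, iβv)` and `w⁻ = (iv, βv)` satisfy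
`H w⁺ = +i√(λ²h²/4 + αλ/n)·w⁺` and `H w⁻ = −i√(λ²h²/4 + αλ/n)·w⁻`. -/
theorem gpe_linearization_eigenpairs {n : ℕ} (hn : 1 ≤ n) (h : ℝ) (hh : 0 < h) (α : ℝ)
    (L : Matrix (Fin n) (Fin n) ℝ) (lam : ℝ) (hlam : 0 < lam) (v : Fin n → ℝ)
    (hLv : L.mulVec v = lam • v)
    (hge : 0 ≤ lam ^ 2 * h ^ 2 / 4 + α * lam / n)
    (H : Matrix (Fin n ⊕ Fin n) (Fin n ⊕ Fin n) ℂ)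
    (hH : H = Matrix.fromBlocks 0 ((1 / (n : ℂ)) • L.map (fun x => (x : ℂ)))
      (-((α : ℂ) • (1 : Matrix (Fin n) (Fin n) ℂ))
        - (((n : ℂ) * (h : ℂ) ^ 2 / 4) • L.map (fun x => (x : ℂ)))) 0)
    (β : ℝ) (hβ : β = Real.sqrt ((n : ℝ) ^ 2 * h ^ 2 / 4 + α * n / lam))
    (μ : ℝ) (hμ : μ = Real.sqrt (lam ^ 2 * h ^ 2 / 4 + α * lam / n)) :
    H.mulVec (Sum.elim (fun j => ((v j : ℝ) : ℂ)) (fun j => Complex.I * (β : ℂ) * (v j : ℂ)))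
      = (Complex.I * (μ : ℂ)) •
        Sum.elim (fun j => ((v j : ℝ) : ℂ)) (fun j => Complex.I * (β : ℂ) * (v j : ℂ)) ∧
    H.mulVec (Sum.elim (fun j => Complex.I * (v j : ℂ)) (fun j => (β : ℂ) * (v j : ℂ)))
      = (-(Complex.I * (μ : ℂ))) •
        Sum.elim (fun j => Complex.I * (v j : ℂ)) (fun j => (β : ℂ) * (v j : ℂ)) := by
  have hn0 : (0 : ℝ) < n := by exact_mod_cast hn
  have hμβ : μ = lam / n * β := by
    rw [hμ, hβ, ← Real.sqrt_sq (div_pos hlam hn0).le, ← Real.sqrt_mul (sq_nonneg _)]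
    congr 1
    field_simp
  have hμ_sq : μ ^ 2 = lam ^ 2 * h ^ 2 / 4 + α * lam / n := by rw [hμ, Real.sq_sqrt hge]
  have hprod : μ * β = α + n * h ^ 2 / 4 * lam := by
    have hβμ : β = n / lam * μ := by
      rw [hμβ]
      field_simp
    calc μ * β = n / lam * μ ^ 2 := by rw [hβμ]; ring
      _ = α + n * h ^ 2 / 4 * lam := by
        rw [hμ_sq]
        field_simp
        ring
  have hμβ' : (1 / (n : ℂ)) * lam * β = μ := by
    rw [hμβ]
    push_cast
    ring
  have hprod' : (α : ℂ) + n * h ^ 2 / 4 * lam = μ * β := by exact_mod_cast hprod.symm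
  have key (a b : ℂ) := fromBlocks_zero_diag_mulVec_elim_smul
    (map_ofReal_mulVec_of_mulVec_eq_smul hLv) (1 / (n : ℂ)) α (n * h ^ 2 / 4) a b
  rw [← hH, hprod'] at key
  constructor
  · convert key 1 (Complex.I * β) using 1
    · rw [one_smul]
      rfl
    · ext (j | j) : 1 <;> simp only [Pi.smul_apply, Sum.elim_inl, Sum.elim_inr, smul_eq_mul]
      · linear_combination (-Complex.I * v j) * hμβ'
      · linear_combination (μ * β * v j : ℂ) * Complex.I_sq
  · refine (key Complex.I β).trans ?_
    ext (j | j) : 1 <;> simp only [Pi.smul_apply, Sum.elim_inl, Sum.elim_inr, smul_eq_mul]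
    · linear_combination (v j : ℂ) * hμβ' + (μ * v j : ℂ) * Complex.I_sq
    · ring
end
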